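/- Let q ∈ ℂ be nonzero and not a root of unity, let A be a unital associative ℂ-algebra, and let a, b, c, d ∈ A satisfy the SL_q(2) relations. For a natural number n, define the matrix $F \in M_{n+1}(A)$ (rows and columns indexed by l, k ∈ {0,…,n}) by $F_{lk} = \binom{n}{l}_{q^2}(-q)^{-l}\,b^{l}d^{n-l}\,a^{n-k}c^{k}$. Then F is idempotent: F·F = F in the matrix ring $M_{n+1}(A)$. (F is the projector matrix $f_{-n}$ giving the right projective module structure of the quantum Hopf line bundle of winding number $-n$.) -/

import Mathlib

/-- The `x`-binomial coefficient
`(x-1)(x²-1)⋯(xⁿ-1) / [(x-1)⋯(x^k-1) · (x-1)⋯(x^(n-k)-1)]`. -/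
noncomputable def qbin (x : ℂ) (n k : ℕ) : ℂ :=
  (∏ i ∈ Finset.range n, (x ^ (i + 1) - 1)) /
    ((∏ i ∈ Finset.range k, (x ^ (i + 1) - 1)) *
      (∏ i ∈ Finset.range (n - k), (x ^ (i + 1) - 1)))

theorem qbin_zero_right (x : ℂ) (hx : ∀ k : ℕ, x ^ (k + 1) - 1 ≠ 0) (n : ℕ) :
    qbin x n 0 = 1 := by
  have h := Finset.prod_ne_zero_iff.mpr fun i (_ : i ∈ Finset.range n) => hx i
  simp [qbin, div_self h]

theorem qbin_self (x : ℂ) (hx : ∀ k : ℕ, x ^ (k + 1) - 1 ≠ 0) (n : ℕ) :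
    qbin x n n = 1 := by
  have h := Finset.prod_ne_zero_iff.mpr fun i (_ : i ∈ Finset.range n) => hx i
  simp [qbin, div_self h]

/-- The `x`-analogue of Pascal's rule. -/
theorem qbin_succ_succ (x : ℂ) (hx : ∀ k : ℕ, x ^ (k + 1) - 1 ≠ 0) {n k : ℕ} (hk : k < n) :
    qbin x (n + 1) (k + 1) = qbin x n (k + 1) + x ^ (n - k) * qbin x n k := by
  obtain ⟨m, rfl⟩ := Nat.exists_eq_add_of_lt hk
  have e1 : k + m + 1 + 1 - (k + 1) = m + 1 := by omega
  have e2 : k + m + 1 - (k + 1) = m := by omega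
  have e3 : k + m + 1 - k = m + 1 := by omega
  have hP : ∀ j, ∏ i ∈ Finset.range j, (x ^ (i + 1) - 1) ≠ 0 := fun j =>
    Finset.prod_ne_zero_iff.mpr fun i _ => hx i
  have hPk := hP k
  have hPm := hP m
  have hxk := hx k
  have hxm := hx m
  simp only [qbin, e1, e2, e3]
  rw [Finset.prod_range_succ _ (k + m + 1), Finset.prod_range_succ _ k,
    Finset.prod_range_succ _ m]
  generalize ∏ i ∈ Finset.range (k + m + 1), (x ^ (i + 1) - 1) = N
  field_simp
  ring

/-- An element `z` with `a z = r z a` satisfies `aᵐ z = rᵐ z aᵐ`. -/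
theorem pow_mul_eq_smul_of_mul_eq_smul {A : Type*} [Ring A] [Algebra ℂ A] {a z : A} {r : ℂ}
    (h : a * z = r • (z * a)) (m : ℕ) : a ^ m * z = r ^ m • (z * a ^ m) := by
  induction m with
  | zero => simp
  | succ m ih =>
    rw [pow_succ, mul_assoc, h, mul_smul_comm, ← mul_assoc, ih, smul_mul_assoc, smul_smul,
      mul_assoc, pow_succ, mul_comm r]

/-- If `a z = x⁻¹ z a` and `a d + w z = 1`, then the `x`-binomial expansion
`∑ₖ (n choose k)ₓ wᵏ aⁿ⁻ᵏ zᵏ dⁿ⁻ᵏ` equals `1`. -/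
theorem sum_qbin_smul_eq_one {A : Type*} [Ring A] [Algebra ℂ A] {a z d : A} {x w : ℂ}
    (hx0 : x ≠ 0) (hx : ∀ k : ℕ, x ^ (k + 1) - 1 ≠ 0)
    (haz : a * z = x⁻¹ • (z * a)) (had : a * d + w • z = 1) (n : ℕ) :
    ∑ k ∈ Finset.range (n + 1),
      (qbin x n k * w ^ k) • (a ^ (n - k) * z ^ k * d ^ (n - k)) = 1 := by
  induction n with
  | zero => simp [qbin]
  | succ n ih =>
    set T : ℕ → A := fun k => (qbin x n k * w ^ k) • (a ^ (n - k) * z ^ k * d ^ (n - k)) with hT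
    have hP : ∀ k ≤ n, a * T k * d =
        (qbin x n k * w ^ k) • (a ^ (n + 1 - k) * z ^ k * d ^ (n + 1 - k)) := by
      intro k hk
      rw [Nat.succ_sub hk, pow_succ' a, pow_succ d]
      simp only [hT, mul_smul_comm, smul_mul_assoc, mul_assoc]
    have hQ : ∀ k, w • (z * T k) =
        (x ^ (n - k) * qbin x n k * w ^ (k + 1)) •
          (a ^ (n - k) * z ^ (k + 1) * d ^ (n - k)) := by
      intro k
      rw [pow_succ' z, ← mul_assoc (a ^ (n - k)), pow_mul_eq_smul_of_mul_eq_smul haz]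
      simp only [hT, mul_smul_comm, smul_mul_assoc, mul_assoc, smul_smul]
      congr 1
      have := pow_ne_zero (n - k) hx0
      rw [inv_pow]
      field_simp
      ring
    have hmid : ∀ k ∈ Finset.range n,
        (qbin x (n + 1) (k + 1) * w ^ (k + 1)) •
          (a ^ (n + 1 - (k + 1)) * z ^ (k + 1) * d ^ (n + 1 - (k + 1))) =
        a * T (k + 1) * d + w • (z * T k) := by
      intro k hk
      have hk := Finset.mem_range.mp hk
      rw [hP _ hk, hQ, qbin_succ_succ x hx hk, Nat.add_sub_add_right, add_mul, add_smul]
    have hfirst : (qbin x (n + 1) 0 * w ^ 0) • (a ^ (n + 1 - 0) * z ^ 0 * d ^ (n + 1 - 0)) =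
        a * T 0 * d := by
      rw [hP 0 n.zero_le, qbin_zero_right x hx, qbin_zero_right x hx]
    have hlast : (qbin x (n + 1) (n + 1) * w ^ (n + 1)) •
        (a ^ (n + 1 - (n + 1)) * z ^ (n + 1) * d ^ (n + 1 - (n + 1))) = w • (z * T n) := by
      rw [hQ, qbin_self x hx, qbin_self x hx]
      simp
    have hsumP : ∑ k ∈ Finset.range (n + 1), a * T k * d = a * d := by
      rw [← Finset.sum_mul, ← Finset.mul_sum, ih, mul_one]
    have hsumQ : ∑ k ∈ Finset.range (n + 1), w • (z * T k) = w • z := by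
      rw [← Finset.smul_sum, ← Finset.mul_sum, ih, mul_one]
    rw [Finset.sum_range_succ'] at hsumP
    rw [Finset.sum_range_succ] at hsumQ
    rw [Finset.sum_range_succ', Finset.sum_range_succ, Finset.sum_congr rfl hmid, hfirst, hlast,
      Finset.sum_add_distrib, ← had, ← hsumP, ← hsumQ]
    abel

theorem stmt14 (q : ℂ) (hq : q ≠ 0) (hroot : ∀ k : ℕ, 0 < k → q ^ k ≠ 1)
    (A : Type*) [Ring A] [Algebra ℂ A] (a b c d : A)
    (hab : a * b = q⁻¹ • (b * a)) (hac : a * c = q⁻¹ • (c * a))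
    (hbd : b * d = q⁻¹ • (d * b)) (hbc : b * c = c * b)
    (hcd : c * d = q⁻¹ • (d * c))
    (hadda : a * d - d * a = (q⁻¹ - q) • (b * c))
    (had : a * d - q⁻¹ • (b * c) = 1) (hda : d * a - q • (b * c) = 1)
    (n : ℕ) (F : Matrix (Fin (n + 1)) (Fin (n + 1)) A)
    (hF : ∀ l k : Fin (n + 1), F l k =
      (qbin (q ^ 2) n l * (-q) ^ (-(l : ℤ))) •
        (b ^ (l : ℕ) * d ^ (n - (l : ℕ)) * a ^ (n - (k : ℕ)) * c ^ (k : ℕ))) :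
    F * F = F := by
  have hx : ∀ k : ℕ, (q ^ 2) ^ (k + 1) - 1 ≠ 0 := fun k => by
    rw [← pow_mul, sub_ne_zero]
    exact hroot _ (by positivity)
  have haz : a * (c * b) = (q ^ 2)⁻¹ • (c * b * a) := by
    rw [← mul_assoc, hac, smul_mul_assoc, mul_assoc, hab, mul_smul_comm, smul_smul, mul_assoc]
    congr 1
    rw [sq, mul_inv]
  have hdet : a * d + (-q)⁻¹ • (c * b) = 1 := by
    rw [← hbc, inv_neg, neg_smul, ← sub_eq_add_neg, had]
  have hsum := sum_qbin_smul_eq_one (pow_ne_zero 2 hq) hx haz hdet n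
  rw [Finset.sum_range] at hsum
  have hcomm : Commute c b := hbc.symm
  ext l k
  set X := b ^ (l : ℕ) * d ^ (n - (l : ℕ))
  set Y := a ^ (n - (k : ℕ)) * c ^ (k : ℕ)
  set s := qbin (q ^ 2) n l * (-q) ^ (-(l : ℤ))
  have hterm : ∀ j : Fin (n + 1), F l j * F j k =
      s • (X * ((qbin (q ^ 2) n j * (-q)⁻¹ ^ (j : ℕ)) •
        (a ^ (n - (j : ℕ)) * (c * b) ^ (j : ℕ) * d ^ (n - (j : ℕ)))) * Y) := by
    intro j
    rw [hF, hF, hcomm.mul_pow, zpow_neg (-q) (j : ℤ), zpow_natCast, ← inv_pow]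
    simp only [X, Y, s, mul_smul_comm, smul_mul_assoc, mul_assoc]
    rw [smul_comm]
  rw [Matrix.mul_apply, Finset.sum_congr rfl fun j _ => hterm j, ← Finset.smul_sum,
    ← Finset.sum_mul, ← Finset.mul_sum, hsum, mul_one, hF]
  simp only [X, Y, s, mul_assoc]
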